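/- (Push invariant preservation, key step in the proof of Lemma 3) Let π̂ : V → ℝ and, for each k ≥ 0, let r^{(k)} : V → ℝ, with r^{(k)} identically zero for all but finitely many k. Fix a node q and a hop index w ≥ 0, and set ρ = r^{(w)}(q). Define the updated state by: π̂'(q) = π̂(q) + α_w·ρ and π̂'(v) = π̂(v) for v ≠ q; r'^{(w)}(q) = 0 and r'^{(w)}(v) = r^{(w)}(v) for v ≠ q; r'^{(w+1)}(o) = r^{(w+1)}(o) + (1 − α_w)·ρ / d(q) for every neighbor o of q, and r'^{(w+1)}(v) = r^{(w+1)}(v) for non-neighbors v of q; and r'^{(k)} = r^{(k)} for all k ∉ {w, w+1}. Then for every node u: π̂'(u) + Σ_{k≥0} Σ_{v∈V} r'^{(k)}(v)·h_u^k(v) = π̂(u) + Σ_{k≥0} Σ_{v∈V} r^{(k)}(v)·h_u^k(v). -/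

import Mathlib

/-- `h_u^k(v) = α_k · [v = u] + Σ_{l=1}^{∞} α_{k+l} · (∏_{j=k}^{k+l-1} (1 − α_j)) · P^l(v, u)`. -/
noncomputable def hFun {V : Type*} [Fintype V] [DecidableEq V]
    (P : Matrix V V ℝ) (α : ℕ → ℝ) (u : V) (k : ℕ) (v : V) : ℝ :=
  α k * (if v = u then 1 else 0) +
    ∑' l : ℕ, α (k + (l + 1)) * (∏ j ∈ Finset.range (l + 1), (1 - α (k + j))) *
      (P ^ (l + 1)) v u

theorem aux_pow {V : Type*} [Fintype V] [DecidableEq V] (P : Matrix V V ℝ)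
    (h0 : ∀ u v, 0 ≤ P u v) (h1 : ∀ u, ∑ v, P u v = 1) (l : ℕ) :
    ∀ v u, 0 ≤ (P ^ l) v u ∧ (P ^ l) v u ≤ 1 := by
  induction l with
  | zero =>
    intro v u
    rw [pow_zero, Matrix.one_apply]
    split_ifs <;> norm_num
  | succ l ih =>
    intro v u
    rw [pow_succ', Matrix.mul_apply]
    constructor
    · exact Finset.sum_nonneg fun o _ => mul_nonneg (h0 v o) (ih o u).1
    · calc ∑ o, P v o * (P ^ l) o u ≤ ∑ o, P v o :=
            Finset.sum_le_sum fun o _ => mul_le_of_le_one_right (h0 v o) (ih o u).2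
        _ = 1 := h1 v

noncomputable def gTerm {V : Type*} [Fintype V] [DecidableEq V]
    (P : Matrix V V ℝ) (α : ℕ → ℝ) (u : V) (k : ℕ) (v : V) (l : ℕ) : ℝ :=
  α (k + l) * (∏ j ∈ Finset.range l, (1 - α (k + j))) * (P ^ l) v u

theorem gTerm_summable {V : Type*} [Fintype V] [DecidableEq V] (P : Matrix V V ℝ)
    (h0 : ∀ u v, 0 ≤ P u v) (h1 : ∀ u, ∑ v, P u v = 1)
    (α : ℕ → ℝ) (a : ℝ) (ha : 0 < a) (ha1 : a ≤ 1)
    (hα : ∀ k : ℕ, a ≤ α k ∧ α k ≤ 1) (u : V) (k : ℕ) (v : V) :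
    Summable (gTerm P α u k v) := by
  have hpn : ∀ l, 0 ≤ ∏ j ∈ Finset.range l, (1 - α (k + j)) := fun l =>
    Finset.prod_nonneg fun j _ => by linarith [(hα (k + j)).2]
  have hp : ∀ l, ∏ j ∈ Finset.range l, (1 - α (k + j)) ≤ (1 - a) ^ l := fun l => by
    have := Finset.prod_le_prod (s := Finset.range l) (f := fun j => 1 - α (k + j))
      (g := fun _ => 1 - a) (fun j _ => by linarith [(hα (k + j)).2])
      (fun j _ => by linarith [(hα (k + j)).1])
    simpa using this
  refine Summable.of_nonneg_of_le (f := fun l => (1 - a) ^ l) ?_ ?_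
    (summable_geometric_of_lt_one (by linarith) (by linarith))
  · intro l
    have := (hα (k + l)).1
    exact mul_nonneg (mul_nonneg (by linarith) (hpn l)) (aux_pow P h0 h1 l v u).1
  · intro l
    have h2 := hα (k + l)
    have h3 := aux_pow P h0 h1 l v u
    unfold gTerm
    have h4 : 0 ≤ α (k + l) := by linarith
    calc _ ≤ α (k + l) * (∏ j ∈ Finset.range l, (1 - α (k + j))) :=
          mul_le_of_le_one_right (mul_nonneg h4 (hpn l)) h3.2
      _ ≤ ∏ j ∈ Finset.range l, (1 - α (k + j)) := mul_le_of_le_one_left (hpn l) h2.2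
      _ ≤ _ := hp l

theorem gTerm_succ {V : Type*} [Fintype V] [DecidableEq V] (P : Matrix V V ℝ)
    (α : ℕ → ℝ) (u : V) (k : ℕ) (v : V) (l : ℕ) :
    gTerm P α u k v (l + 1) = ∑ o, (1 - α k) * P v o * gTerm P α u (k + 1) o l := by
  unfold gTerm
  rw [pow_succ', Matrix.mul_apply, Finset.mul_sum, Finset.prod_range_succ']
  refine Finset.sum_congr rfl fun o _ => ?_
  have h1 : k + (l + 1) = k + 1 + l := by ring
  have h2 : ∏ j ∈ Finset.range l, (1 - α (k + (j + 1))) =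
      ∏ j ∈ Finset.range l, (1 - α (k + 1 + j)) :=
    Finset.prod_congr rfl fun j _ => by rw [show k + (j + 1) = k + 1 + j by ring]
  rw [h1, h2, add_zero]
  ring

theorem hFun_eq {V : Type*} [Fintype V] [DecidableEq V] (P : Matrix V V ℝ)
    (α : ℕ → ℝ) (u : V) (k : ℕ) (v : V) (hs : Summable (gTerm P α u k v)) :
    hFun P α u k v = ∑' l, gTerm P α u k v l := by
  rw [hs.tsum_eq_zero_add]
  simp [hFun, gTerm, Matrix.one_apply]

theorem hFun_rec {V : Type*} [Fintype V] [DecidableEq V] (P : Matrix V V ℝ)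
    (α : ℕ → ℝ) (u : V) (hs : ∀ k v, Summable (gTerm P α u k v)) (k : ℕ) (v : V) :
    hFun P α u k v = α k * (if v = u then 1 else 0) +
      ∑ o, (1 - α k) * P v o * hFun P α u (k + 1) o := by
  have h : hFun P α u k v = α k * (if v = u then 1 else 0) +
      ∑' l, gTerm P α u k v (l + 1) := rfl
  rw [h]
  congr 1
  simp only [gTerm_succ]
  rw [Summable.tsum_finsetSum fun o _ => (hs (k + 1) o).mul_left _]
  refine Finset.sum_congr rfl fun o _ => ?_
  rw [tsum_mul_left, hFun_eq P α u _ _ (hs _ _)]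

/-- Push invariant preservation, key step in the proof of Lemma 3:
a push operation at node `q` and hop `w` (with `ρ = r^{(w)}(q)`) leaves the quantity
`π̂(u) + Σ_{k≥0} Σ_{v∈V} r^{(k)}(v)·h_u^k(v)` unchanged, for every node `u`.
The residues `r^{(k)}` vanish for all but finitely many `k`, so the sum over `k` is a
`tsum` of a finitely supported family. The updated state `(π̂', r')` is described by the
hypotheses `hπ'q, hπ', hr'wq, hr'w, hr'adj, hr'nonadj, hr'other`. -/
theorem stmt_10 {V : Type*} [Fintype V] [DecidableEq V] (G : SimpleGraph V)
    [DecidableRel G.Adj] (hd : ∀ v, 0 < G.degree v)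
    (P : Matrix V V ℝ)
    (hP : ∀ u v, P u v = if G.Adj u v then (1 : ℝ) / (G.degree u : ℝ) else 0)
    (α : ℕ → ℝ) (αmin : ℝ) (hαmin_pos : 0 < αmin) (hαmin_le : αmin ≤ 1)
    (hα : ∀ k : ℕ, αmin ≤ α k ∧ α k ≤ 1)
    (πhat : V → ℝ) (r : ℕ → V → ℝ)
    (hfin : ∃ N : ℕ, ∀ k, N ≤ k → ∀ v, r k v = 0)
    (q : V) (w : ℕ)
    (πhat' : V → ℝ) (r' : ℕ → V → ℝ)
    (hπ'q : πhat' q = πhat q + α w * r w q)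
    (hπ' : ∀ v, v ≠ q → πhat' v = πhat v)
    (hr'wq : r' w q = 0)
    (hr'w : ∀ v, v ≠ q → r' w v = r w v)
    (hr'adj : ∀ o, G.Adj q o →
      r' (w + 1) o = r (w + 1) o + (1 - α w) * r w q / (G.degree q : ℝ))
    (hr'nonadj : ∀ v, ¬ G.Adj q v → r' (w + 1) v = r (w + 1) v)
    (hr'other : ∀ k, k ≠ w → k ≠ w + 1 → r' k = r k) :
    ∀ u, πhat' u + ∑' k : ℕ, ∑ v, r' k v * hFun P α u k v =
        πhat u + ∑' k : ℕ, ∑ v, r k v * hFun P α u k v := by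
  intro u
  have h0 : ∀ u v, 0 ≤ P u v := fun u v => by
    rw [hP]; split_ifs <;> positivity
  have h1 : ∀ u, ∑ v, P u v = 1 := fun u => by
    have h2 : (G.degree u : ℝ) ≠ 0 := by exact_mod_cast (hd u).ne'
    simp only [hP]
    rw [← Finset.sum_filter, Finset.sum_const, ← SimpleGraph.neighborFinset_eq_filter,
      SimpleGraph.card_neighborFinset_eq_degree, nsmul_eq_mul]
    field_simp
  have hs := gTerm_summable P h0 h1 α αmin hαmin_pos hαmin_le hα u
  have hrec := hFun_rec P α u hs w q
  have hF : Summable fun k => ∑ v, r k v * hFun P α u k v := by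
    obtain ⟨N, hN⟩ := hfin
    refine summable_of_ne_finset_zero (s := Finset.range N) fun k hk => ?_
    refine Finset.sum_eq_zero fun v _ => ?_
    rw [hN k (by simpa using hk), zero_mul]
  have hD0 : ∀ k ∉ ({w, w + 1} : Finset ℕ),
      ∑ v, (r' k v - r k v) * hFun P α u k v = 0 := fun k hk => by
    simp only [Finset.mem_insert, Finset.mem_singleton, not_or] at hk
    simp [hr'other k hk.1 hk.2]
  have hD : Summable fun k => ∑ v, (r' k v - r k v) * hFun P α u k v :=
    summable_of_ne_finset_zero hD0
  have hsplit : ∀ k, ∑ v, r' k v * hFun P α u k v =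
      ∑ v, r k v * hFun P α u k v + ∑ v, (r' k v - r k v) * hFun P α u k v := fun k => by
    rw [← Finset.sum_add_distrib]
    exact Finset.sum_congr rfl fun v _ => by ring
  simp only [hsplit]
  rw [hF.tsum_add hD, tsum_eq_sum hD0, Finset.sum_pair (by omega)]
  have hA : ∑ v, (r' w v - r w v) * hFun P α u w v = - r w q * hFun P α u w q := by
    rw [Finset.sum_eq_single q]
    · rw [hr'wq]; ring
    · intro v _ hv
      rw [hr'w v hv]; ring
    · simp
  have hB : ∑ v, (r' (w + 1) v - r (w + 1) v) * hFun P α u (w + 1) v =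
      r w q * ∑ o, (1 - α w) * P q o * hFun P α u (w + 1) o := by
    rw [Finset.mul_sum]
    refine Finset.sum_congr rfl fun v _ => ?_
    rw [hP]
    by_cases hv : G.Adj q v
    · rw [hr'adj v hv, if_pos hv]; ring
    · rw [hr'nonadj v hv, if_neg hv]; ring
  rw [hA, hB, hrec]
  by_cases hu : q = u
  · subst hu
    rw [hπ'q, if_pos rfl]; ring
  · rw [hπ' u (Ne.symm hu), if_neg hu]; ring
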